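/- In any 3-coloring of the 3×3 grid graph P_3 □ P_3 that is a proper coloring with no bicolored path on 5 vertices, every pair of two consecutive columns contains each of the three colors exactly twice. -/

import Mathlib

open SimpleGraph

/-- `f` is a `P_k`-coloring of `G`: a proper vertex coloring such that no path on `k`
vertices is bicolored, i.e. every path on `k` vertices receives at least 3 distinct colors. -/
def IsPkColoring {V α : Type*} [DecidableEq α] (G : SimpleGraph V) (k : ℕ) (f : V → α) : Prop :=
  (∀ u w : V, G.Adj u w → f u ≠ f w) ∧
  ∀ (u w : V) (p : G.Walk u w), p.IsPath → p.length + 1 = k →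
    3 ≤ (p.support.map f).toFinset.card

theorem IsPkColoring.ne_of_alternating {V α : Type*} [DecidableEq α] {G : SimpleGraph V}
    {f : V → α} (hf : IsPkColoring G 5 f) {a b c d e : V} (hab : G.Adj a b) (hbc : G.Adj b c)
    (hcd : G.Adj c d) (hde : G.Adj d e) (hnodup : [a, b, c, d, e].Nodup)
    (hac : f a = f c) (hbd : f b = f d) : f c ≠ f e := by
  intro hce
  have h := hf.2 a e (.cons hab (.cons hbc (.cons hcd (.cons hde .nil))))
    (.mk' (by simpa using hnodup)) (by simp)
  have hsub : ([a, b, c, d, e].map f).toFinset ⊆ {f e, f d} := by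
    intro x
    simp only [List.map_cons, List.map_nil, List.mem_toFinset, List.mem_cons, List.not_mem_nil,
      Finset.mem_insert, Finset.mem_singleton, hac, hbd, hce]
    tauto
  have h₂ := (Finset.card_le_card hsub).trans Finset.card_le_two
  simp only [Walk.support_cons, Walk.support_nil] at h
  omega

set_option synthInstance.maxSize 2000 in
/-- The grid is labelled row by row as `a b c`, `d e f`, `g h i`. -/
theorem grid_coloring_has_alternating_path :
    ∀ b c : Fin 3, b ≠ c → ∀ f, c ≠ f → ∀ e, b ≠ e → e ≠ f →
    ∀ d, d ≠ e → (b = f → c = e → f ≠ d) →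
    ∀ a, a ≠ b → a ≠ d → (d = b → a = c → b ≠ f) → (a = e → d = f → e ≠ c) →
    ∀ h, e ≠ h → ∀ i, h ≠ i → f ≠ i →
    (a = e → b = f → e ≠ i) → (c = e → b = h → e ≠ i) → (b = f → c = i → f ≠ h) →
    ∀ g, d ≠ g → g ≠ h → c = e ∧ f = h ∧ e = g := by
  decide

/-- The `3 × 3` grid has no `P₅`-coloring with three colors. -/
theorem not_isPkColoring_grid (f : Fin 3 × Fin 3 → Fin 3) :
    ¬ IsPkColoring ((pathGraph 3).boxProd (pathGraph 3)) 5 f := by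
  intro hf
  have row (i : Fin 3) {j k : Fin 3} (hjk : (pathGraph 3).Adj j k) :
      ((pathGraph 3).boxProd (pathGraph 3)).Adj (i, j) (i, k) := by simpa using hjk
  have col (j : Fin 3) {i k : Fin 3} (hik : (pathGraph 3).Adj i k) :
      ((pathGraph 3).boxProd (pathGraph 3)).Adj (i, j) (k, j) := by simpa using hik
  have h₀₁ : (pathGraph 3).Adj 0 1 := by simp [pathGraph_adj]
  have h₁₂ : (pathGraph 3).Adj 1 2 := by simp [pathGraph_adj]
  have ab := row 0 h₀₁
  have bc := row 0 h₁₂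
  have de := row 1 h₀₁
  have ef := row 1 h₁₂
  have gh := row 2 h₀₁
  have hi := row 2 h₁₂
  have ad := col 0 h₀₁
  have dg := col 0 h₁₂
  have be := col 1 h₀₁
  have eh := col 1 h₁₂
  have cf := col 2 h₀₁
  have fi := col 2 h₁₂
  obtain ⟨hce, hfh, heg⟩ := grid_coloring_has_alternating_path _ _ (hf.1 _ _ bc)
    _ (hf.1 _ _ cf) _ (hf.1 _ _ be) (hf.1 _ _ ef)
    _ (hf.1 _ _ de) (hf.ne_of_alternating bc cf ef.symm de.symm (by decide))
    _ (hf.1 _ _ ab) (hf.1 _ _ ad) (hf.ne_of_alternating ad.symm ab bc cf (by decide))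
    (hf.ne_of_alternating ad de ef cf.symm (by decide))
    _ (hf.1 _ _ eh) _ (hf.1 _ _ hi) (hf.1 _ _ fi)
    (hf.ne_of_alternating ab be ef fi (by decide))
    (hf.ne_of_alternating bc.symm be eh hi (by decide))
    (hf.ne_of_alternating bc cf fi hi.symm (by decide))
    _ (hf.1 _ _ dg) (hf.1 _ _ gh)
  exact hf.ne_of_alternating cf ef.symm eh gh.symm (by decide) hce hfh heg

/-- In any proper 3-coloring of the 3×3 grid `P₃ □ P₃` with no bicolored path on 5
vertices, each pair of consecutive columns contains each of the three colors exactly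
twice.  Here the vertex `(i, j)` lies in column `j`. -/
theorem consecutive_columns_two_of_each_color
    (f : Fin 3 × Fin 3 → Fin 3)
    (hf : IsPkColoring ((pathGraph 3).boxProd (pathGraph 3)) 5 f)
    (j₁ j₂ : Fin 3) (hj : (j₁ : ℕ) + 1 = (j₂ : ℕ)) (c : Fin 3) :
    (Finset.univ.filter
        (fun x : Fin 3 × Fin 3 => (x.2 = j₁ ∨ x.2 = j₂) ∧ f x = c)).card = 2 := by
  exact absurd hf (not_isPkColoring_grid f)
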